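/- arXiv:2303.00228 — 2 statements merged into one kernel-verified Lean document; each statement's English description precedes it below -/
import Mathlib

section
/- (Gaussian mechanism is (ε,δ)-differentially private.) Let ε ∈ (0, 1), δ ∈ (0, 1), Δ > 0, n ≥ 1, and let σ = Δ·√(2·log(1.25/δ))/ε. Let μ be the product measure on ℝⁿ of n independent Gaussian measures with mean 0 and variance σ². Then for all a, b ∈ ℝⁿ with ‖a − b‖₂ ≤ Δ and every measurable set S ⊆ ℝⁿ, (μ.map(x ↦ x + a))(S) ≤ exp(ε) · (μ.map(x ↦ x + b))(S) + δ. -/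
open MeasureTheory ProbabilityTheory

theorem aux_lintegral_prod {n : ℕ} (f : Fin n → ℝ → ENNReal) (hf : ∀ i, Measurable (f i)) :
    ∫⁻ x : Fin n → ℝ, ∏ i, f i (x i) ∂(Measure.pi fun _ => volume) = ∏ i, ∫⁻ x, f i x := by
  induction n with
  | zero => simp
  | succ n ih =>
    rw [← ((measurePreserving_piFinSuccAbove (fun _ : Fin (n+1) => (volume : Measure ℝ)) 0).symm).lintegral_comp_emb
      (MeasurableEquiv.measurableEmbedding _)]
    simp_rw [MeasurableEquiv.piFinSuccAbove_symm_apply, Fin.insertNthEquiv,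
            Fin.prod_univ_succ, Fin.insertNth_zero, Equiv.coe_fn_mk, Fin.cons_succ,
            Fin.cons_zero]
    rw [← ih (fun i => f i.succ) (fun i => hf _)]
    refine lintegral_prod_mul (f := f 0) (g := fun y : Fin n → ℝ => ∏ i : Fin n, f i.succ (y i))
      (hf 0).aemeasurable ?_
    refine Measurable.aemeasurable ?_
    exact Finset.measurable_prod _ fun i _ => (hf _).comp (measurable_pi_apply i)

theorem aux_pi_gaussian {n : ℕ} (a : Fin n → ℝ) (v : NNReal) (hv : v ≠ 0) :
    (Measure.pi fun i => gaussianReal (a i) v) =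
      (Measure.pi fun _ : Fin n => (volume : Measure ℝ)).withDensity
        (fun x => ∏ i, gaussianPDF (a i) v (x i)) := by
  refine Measure.pi_eq fun s hs => ?_
  rw [withDensity_apply _ (MeasurableSet.univ_pi hs),
    ← lintegral_indicator (MeasurableSet.univ_pi hs)]
  have : ∀ x : Fin n → ℝ, (Set.univ.pi s).indicator (fun x => ∏ i, gaussianPDF (a i) v (x i)) x
      = ∏ i, (s i).indicator (gaussianPDF (a i) v) (x i) := by
    intro x
    by_cases hx : x ∈ Set.univ.pi s
    · rw [Set.indicator_of_mem hx]
      exact Finset.prod_congr rfl fun i _ => (Set.indicator_of_mem (hx i trivial) _).symm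
    · rw [Set.indicator_of_notMem hx]
      simp only [Set.mem_pi, Set.mem_univ, true_imp_iff, not_forall] at hx
      obtain ⟨i, hi⟩ := hx
      exact (Finset.prod_eq_zero (Finset.mem_univ i) (Set.indicator_of_notMem hi _)).symm
  simp_rw [this]
  rw [aux_lintegral_prod _ fun i => (measurable_gaussianPDF _ _).indicator (hs i)]
  refine Finset.prod_congr rfl fun i _ => ?_
  rw [lintegral_indicator (hs i), gaussianReal_of_var_ne_zero _ hv, withDensity_apply _ (hs i)]

theorem aux_prod_pdf {n : ℕ} (a x : Fin n → ℝ) (v : NNReal) :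
    ∏ i, gaussianPDF (a i) v (x i) =
      ENNReal.ofReal ((∏ _i : Fin n, (√(2 * Real.pi * v))⁻¹) *
        Real.exp (-(∑ i, (x i - a i) ^ 2) / (2 * v))) := by
  simp only [gaussianPDF, gaussianPDFReal]
  rw [← ENNReal.ofReal_prod_of_nonneg (fun i _ => by positivity), Finset.prod_mul_distrib,
    ← Real.exp_sum, ← Finset.sum_div, Finset.sum_neg_distrib]

theorem aux_main {n : ℕ} (a b : Fin n → ℝ) (v : NNReal) (hv : v ≠ 0) (ε K l : ℝ) (hK : 0 ≤ K)
    (h : ∀ x : ℝ, 1 ≤ Real.exp (-x) + K * Real.exp (l * x))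
    (S : Set (Fin n → ℝ)) (hS : MeasurableSet S) :
    (Measure.pi fun i => gaussianReal (a i) v) S ≤
      ENNReal.ofReal (Real.exp ε) * (Measure.pi fun i => gaussianReal (b i) v) S +
      ENNReal.ofReal (K * Real.exp (l * (l + 1) * ((∑ i, (a i - b i) ^ 2) / (2 * v)) - l * ε)) := by
  set C := K * Real.exp (l * (l + 1) * ((∑ i, (a i - b i) ^ 2) / (2 * v)) - l * ε) with hC
  have hC0 : 0 ≤ C := by positivity
  let m : Fin n → ℝ := fun i => a i + l * (a i - b i)
  have key : (Measure.pi fun i => gaussianReal (a i) v) S ≤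
      ENNReal.ofReal (Real.exp ε) * (Measure.pi fun i => gaussianReal (b i) v) S +
      ENNReal.ofReal C * (Measure.pi fun i => gaussianReal (m i) v) S := by
    have hmeas : ∀ a : Fin n → ℝ, Measurable fun x : Fin n → ℝ => ∏ i, gaussianPDF (a i) v (x i) :=
      fun a => Finset.measurable_prod _ fun i _ =>
        (measurable_gaussianPDF _ _).comp (measurable_pi_apply i)
    rw [aux_pi_gaussian a v hv, aux_pi_gaussian b v hv, aux_pi_gaussian m v hv,
      withDensity_apply _ hS, withDensity_apply _ hS, withDensity_apply _ hS,
      ← lintegral_const_mul _ (hmeas b), ← lintegral_const_mul _ (hmeas m),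
      ← lintegral_add_left ((hmeas b).const_mul _)]
    refine lintegral_mono fun x => ?_
    simp only [aux_prod_pdf]
    set Z := (∏ _i : Fin n, (√(2 * Real.pi * v))⁻¹)
    have hZ : 0 ≤ Z := by positivity
    rw [← ENNReal.ofReal_mul (by positivity), ← ENNReal.ofReal_mul hC0,
      ← ENNReal.ofReal_add (by positivity) (by positivity)]
    refine ENNReal.ofReal_le_ofReal ?_
    have hM : ∑ i, (x i - m i) ^ 2 = (1 + l) * ∑ i, (x i - a i) ^ 2 - l * ∑ i, (x i - b i) ^ 2
        + l * (l + 1) * ∑ i, (a i - b i) ^ 2 := by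
      simp only [Finset.mul_sum, ← Finset.sum_sub_distrib, ← Finset.sum_add_distrib, m]
      refine Finset.sum_congr rfl fun i _ => ?_
      ring
    rw [hM]
    set A := ∑ i, (x i - a i) ^ 2
    set B := ∑ i, (x i - b i) ^ 2
    set D := ∑ i, (a i - b i) ^ 2
    have h1 := h (B / (2 * v) - A / (2 * v) - ε)
    have h2 := mul_le_mul_of_nonneg_left h1
      (mul_nonneg hZ (Real.exp_pos (-A / (2 * v))).le)
    refine le_trans (le_of_eq (mul_one _).symm) (h2.trans (le_of_eq ?_))
    have e1 : Real.exp ε * Real.exp (-B / (2 * v)) = Real.exp (-A / (2 * v)) *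
        Real.exp (-(B / (2 * v) - A / (2 * v) - ε)) := by
      rw [← Real.exp_add, ← Real.exp_add]; congr 1; ring
    have e2 : Real.exp (l * (l + 1) * (D / (2 * v)) - l * ε) *
        Real.exp (-((1 + l) * A - l * B + l * (l + 1) * D) / (2 * v)) = Real.exp (-A / (2 * v)) *
        Real.exp (l * (B / (2 * v) - A / (2 * v) - ε)) := by
      rw [← Real.exp_add, ← Real.exp_add]; congr 1; ring
    rw [hC]
    linear_combination (-Z) * e1 - Z * K * e2
  refine key.trans ?_
  gcongr
  exact (mul_le_mul_right prob_le_one _).trans (mul_one _).le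

theorem aux_exp_quarter (x : ℝ) : 1 ≤ Real.exp (-x) + 1 / 4 * Real.exp (1 * x) := by
  have h : Real.exp (-x) * Real.exp (1 * x) = 1 := by
    rw [← Real.exp_add]; simp
  nlinarith [Real.exp_pos (-x), Real.exp_pos (1*x), sq_nonneg (Real.exp (-x) - 1 / 4 * Real.exp (1*x))]

theorem aux_exp_gen (l : ℝ) (hl : 1 / 2 ≤ l) (x : ℝ) :
    1 ≤ Real.exp (-x) + 2 / 3 * Real.exp (l * x) := by
  have h1 := Real.add_one_le_exp (-x)
  have h2 := Real.add_one_le_exp (l * x)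
  have p1 := Real.exp_pos (-x)
  have p2 := Real.exp_pos (l * x)
  have h3 : (1 + l) * 1 ≤ (1 + l) * (Real.exp (-x) + 2 / 3 * Real.exp (l * x)) := by
    nlinarith
  exact le_of_mul_le_mul_left h3 (by linarith)

theorem aux_log : (0.22 : ℝ) ≤ Real.log 1.25 := by
  rw [Real.le_log_iff_exp_le (by norm_num)]
  refine le_of_pow_le_pow_left₀ (n := 50) (by norm_num) (by norm_num) ?_
  rw [← Real.exp_nat_mul]
  have : ((50 : ℕ) : ℝ) * 0.22 = (11 : ℕ) * 1 := by norm_num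
  rw [this, Real.exp_nat_mul]
  calc Real.exp 1 ^ 11 ≤ (2.72 : ℝ) ^ 11 := by
        gcongr; exact (Real.exp_one_lt_d9.le.trans (by norm_num))
    _ ≤ _ := by norm_num

theorem aux_exp1 : Real.exp (3 / 2) ≤ 5 := by
  refine le_of_pow_le_pow_left₀ (n := 2) (by norm_num) (by norm_num) ?_
  rw [← Real.exp_nat_mul]
  have : ((2 : ℕ) : ℝ) * (3 / 2) = (3 : ℕ) * 1 := by norm_num
  rw [this, Real.exp_nat_mul]
  calc Real.exp 1 ^ 3 ≤ (2.72 : ℝ) ^ 3 := by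
        gcongr; exact (Real.exp_one_lt_d9.le.trans (by norm_num))
    _ ≤ _ := by norm_num

theorem aux_exp2 : Real.exp (1 / 2) ≤ 15 / 8 := by
  refine le_of_pow_le_pow_left₀ (n := 2) (by norm_num) (by norm_num) ?_
  rw [← Real.exp_nat_mul]
  have : ((2 : ℕ) : ℝ) * (1 / 2) = 1 := by norm_num
  rw [this]
  exact (Real.exp_one_lt_d9.le.trans (by norm_num))

/-- The Gaussian mechanism with `σ = Δ·√(2·log(1.25/δ))/ε` is `(ε,δ)`-differentially
private: for outputs `a, b` with `‖a − b‖₂ ≤ Δ`, the translated product-Gaussian noise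
laws satisfy the `(ε,δ)`-DP inequality. -/
theorem gaussian_mechanism_eps_delta_DP
    {n : ℕ} (hn : 1 ≤ n) (ε δ Δ : ℝ)
    (hε : ε ∈ Set.Ioo (0 : ℝ) 1) (hδ : δ ∈ Set.Ioo (0 : ℝ) 1) (hΔ : 0 < Δ)
    (σ : ℝ) (hσ : σ = Δ * Real.sqrt (2 * Real.log (1.25 / δ)) / ε)
    (μ : Measure (Fin n → ℝ))
    (hμ : μ = Measure.pi fun _ : Fin n => gaussianReal 0 ⟨σ ^ 2, sq_nonneg σ⟩)
    (a b : Fin n → ℝ) (hab : Real.sqrt (∑ i, (a i - b i) ^ 2) ≤ Δ)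
    (S : Set (Fin n → ℝ)) (hS : MeasurableSet S) :
    (μ.map fun x => x + a) S ≤
      ENNReal.ofReal (Real.exp ε) * (μ.map fun x => x + b) S + ENNReal.ofReal δ := by
  obtain ⟨hε0, hε1⟩ := hε
  obtain ⟨hδ0, hδ1⟩ := hδ
  set w := 2 * Real.log (1.25 / δ) with hw
  have hw0 : 0.44 ≤ w := by
    have : Real.log 1.25 ≤ Real.log (1.25 / δ) := by
      refine Real.log_le_log (by norm_num) ?_
      rw [le_div_iff₀ hδ0]; nlinarith
    have := aux_log
    rw [hw]; linarith
  have hwp : 0 < w := by linarith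
  have hδw : δ = 5 / 4 * Real.exp (-w / 2) := by
    have : -w / 2 = - Real.log (1.25 / δ) := by rw [hw]; ring
    rw [this, Real.exp_neg, Real.exp_log (by positivity)]
    field_simp; norm_num
  have hσ2 : σ ^ 2 = Δ ^ 2 * w / ε ^ 2 := by
    rw [hσ, div_pow, mul_pow, Real.sq_sqrt hwp.le]
  have hσp : 0 < σ ^ 2 := by rw [hσ2]; positivity
  set v : NNReal := ⟨σ ^ 2, sq_nonneg σ⟩ with hv
  have hvr : (v : ℝ) = σ ^ 2 := rfl
  have hv0 : v ≠ 0 := by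
    intro h
    rw [h] at hvr
    exact hσp.ne hvr
  have hmap : ∀ c : Fin n → ℝ, μ.map (fun x => x + c) = Measure.pi fun i => gaussianReal (c i) v := by
    intro c
    have : ∀ i, (gaussianReal 0 v).map (fun x => x + c i) = gaussianReal (c i) v := by
      intro i
      rw [gaussianReal_map_add_const, zero_add]
    have h2 := Measure.pi_map_pi (μ := fun _ : Fin n => gaussianReal 0 v)
      (f := fun i x => x + c i)
      (hμ := fun i => by rw [this i]; infer_instance) (fun i => by fun_prop)
    simp only [this] at h2
    rw [hμ]
    exact h2
  rw [hmap a, hmap b]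
  have hD0 : 0 ≤ (∑ i, (a i - b i) ^ 2) / (2 * (v : ℝ)) := by positivity
  have hD : (∑ i, (a i - b i) ^ 2) / (2 * (v : ℝ)) ≤ ε ^ 2 / (2 * w) := by
    have h1 : ∑ i, (a i - b i) ^ 2 ≤ Δ ^ 2 := (Real.sqrt_le_left hΔ.le).1 hab
    rw [hvr, hσ2]
    calc _ ≤ Δ ^ 2 / (2 * (Δ ^ 2 * w / ε ^ 2)) := by gcongr
      _ = _ := by field_simp
  rcases le_total w 1 with hw1 | hw1
  · refine (aux_main a b v hv0 ε (1 / 4) 1 (by norm_num) aux_exp_quarter S hS).trans ?_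
    gcongr
    set D := (∑ i, (a i - b i) ^ 2) / (2 * (v : ℝ))
    have h1 : 1 * (1 + 1) * D - 1 * ε ≤ 3 / 2 + -w / 2 := by
      have h2 : 2 * D ≤ ε ^ 2 / w := by
        calc 2 * D ≤ 2 * (ε ^ 2 / (2 * w)) := by linarith
          _ = _ := by field_simp
      have h3 : ε ^ 2 / w ≤ 3 / 2 + ε - w / 2 := by
        rw [div_le_iff₀ hwp]
        nlinarith [mul_nonneg hε0.le (sub_nonneg.2 hε1.le), mul_nonneg (sub_nonneg.2 hw0) (sub_nonneg.2 hw1),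
          mul_nonneg (sub_nonneg.2 hε1.le) (sub_nonneg.2 hw0), mul_nonneg (sub_nonneg.2 hε1.le) (sub_nonneg.2 hw1)]
      linarith
    calc 1 / 4 * Real.exp (1 * (1 + 1) * D - 1 * ε) ≤ 1 / 4 * Real.exp (3 / 2 + -w / 2) := by gcongr
      _ = 1 / 4 * Real.exp (3 / 2) * Real.exp (-w / 2) := by rw [Real.exp_add]; ring
      _ ≤ 1 / 4 * 5 * Real.exp (-w / 2) := by gcongr; exact aux_exp1
      _ = δ := by rw [hδw]; ring
  · have hwe : 1 ≤ w / ε := by rw [le_div_iff₀ hε0]; linarith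
    have hl : 1 / 2 ≤ w / ε - 1 / 2 := by linarith
    refine (aux_main a b v hv0 ε (2 / 3) (w / ε - 1 / 2) (by norm_num) (aux_exp_gen _ hl) S hS).trans ?_
    gcongr
    set D := (∑ i, (a i - b i) ^ 2) / (2 * (v : ℝ))
    set l := w / ε - 1 / 2 with hldef
    have h1 : l * (l + 1) * D - l * ε ≤ 1 / 2 + -w / 2 := by
      have h2 : l * (l + 1) * D ≤ l * (l + 1) * (ε ^ 2 / (2 * w)) := by
        refine mul_le_mul_of_nonneg_left hD ?_
        nlinarith
      have h3 : l * (l + 1) * (ε ^ 2 / (2 * w)) - l * ε = -w / 2 + ε / 2 - ε ^ 2 / (8 * w) := by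
        rw [hldef]; field_simp; ring
      have h4 : 0 ≤ ε ^ 2 / (8 * w) := by positivity
      linarith
    calc 2 / 3 * Real.exp (l * (l + 1) * D - l * ε) ≤ 2 / 3 * Real.exp (1 / 2 + -w / 2) := by gcongr
      _ = 2 / 3 * Real.exp (1 / 2) * Real.exp (-w / 2) := by rw [Real.exp_add]; ring
      _ ≤ 2 / 3 * (15 / 8) * Real.exp (-w / 2) := by gcongr; exact aux_exp2
      _ = δ := by rw [hδw]; ring
end

section
/- (Conditioning an additive mechanism on a linear-equality invariant preserves ε-DP.) Let n' ≤ n, let g : ℝ^{n'} → ℝⁿ be an injective linear map (parametrizing the kernel of the constraint matrix), let p : ℝⁿ → [0,∞) be a measurable noise density, and suppose 0 < K := ∫_{ℝ^{n'}} p(g(u)) du < ∞. Let ε ≥ 0 and let a, b ∈ ℝⁿ with a − b ∈ range(g), such that p(v − a) ≤ exp(ε)·p(v − b) for all v ∈ ℝⁿ. Define ν_a to be the pushforward under u ↦ a + g(u) of the measure on ℝ^{n'} with density u ↦ p(g(u))/K with respect to Lebesgue measure, and define ν_b analogously with b in place of a. Then for every measurable set E ⊆ ℝⁿ, ν_a(E)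 ≤ exp(ε)·ν_b(E). -/
open MeasureTheory
open scoped ENNReal

/-- Conditioning an additive mechanism on a linear-equality invariant preserves `ε`-DP:
if the noise density satisfies the pointwise `ε`-DP bound and `a − b` lies in the range
of the parametrization `g` of the constraint kernel, then the conditional laws
(supported on the affine subspaces `a + range g = b + range g`, with the data-independent
normalizer `K`) satisfy the `ε`-DP inequality. -/
theorem conditioning_linear_invariant_preserves_DP
    {n n' : ℕ} (hle : n' ≤ n)
    (g : (Fin n' → ℝ) →ₗ[ℝ] (Fin n → ℝ)) (hg : Function.Injective g)
    (p : (Fin n → ℝ) → ℝ) (hp_meas : Measurable p) (hp_nonneg : ∀ v, 0 ≤ p v)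
    (K : ℝ≥0∞) (hK : K = ∫⁻ u, ENNReal.ofReal (p (g u)))
    (hK_pos : 0 < K) (hK_fin : K < ⊤)
    (ε : ℝ) (hε : 0 ≤ ε)
    (a b : Fin n → ℝ) (hab : a - b ∈ LinearMap.range g)
    (hDP : ∀ v : Fin n → ℝ, p (v - a) ≤ Real.exp ε * p (v - b))
    (νa νb : Measure (Fin n → ℝ))
    (hνa : νa = (volume.withDensity fun u : Fin n' → ℝ =>
      ENNReal.ofReal (p (g u)) / K).map fun u => a + g u)
    (hνb : νb = (volume.withDensity fun u : Fin n' → ℝ =>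
      ENNReal.ofReal (p (g u)) / K).map fun u => b + g u)
    (E : Set (Fin n → ℝ)) (hE : MeasurableSet E) :
    νa E ≤ ENNReal.ofReal (Real.exp ε) * νb E := by
  have hgm : Measurable g := (LinearMap.continuous_of_finiteDimensional g).measurable
  have hd : Measurable fun u : Fin n' → ℝ => ENNReal.ofReal (p (g u)) / K :=
    (ENNReal.measurable_ofReal.comp (hp_meas.comp hgm)).div_const K
  have key : ∀ c : Fin n → ℝ, ((volume.withDensity fun u : Fin n' → ℝ =>
      ENNReal.ofReal (p (g u)) / K).map fun u => c + g u) E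
      = ∫⁻ u, ((fun u => c + g u) ⁻¹' E).indicator
          (fun u : Fin n' → ℝ => ENNReal.ofReal (p (g u)) / K) u := by
    intro c
    have hm : Measurable fun u => c + g u := hgm.const_add c
    rw [Measure.map_apply hm hE, withDensity_apply _ (hm hE), lintegral_indicator (hm hE)]
  obtain ⟨w, hw⟩ := hab
  rw [hνa, hνb, key a, key b, ← lintegral_const_mul' _ _ ENNReal.ofReal_ne_top,
    ← lintegral_sub_right_eq_self _ w]
  refine lintegral_mono fun u => ?_
  have h1 : a + g (u - w) = b + g u := by
    rw [map_sub, hw]; abel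
  have h2 := hDP (b + g u)
  have h3 : b + g u - a = g (u - w) := by rw [← h1]; abel
  have h4 : b + g u - b = g u := by abel
  rw [h3, h4] at h2
  by_cases hu : b + g u ∈ E
  · have hu' : a + g (u - w) ∈ E := h1 ▸ hu
    rw [Set.indicator_of_mem (by exact hu'), Set.indicator_of_mem (by exact hu), ← mul_div_assoc,
      ← ENNReal.ofReal_mul (Real.exp_pos ε).le]
    exact ENNReal.div_le_div_right (ENNReal.ofReal_le_ofReal h2) K
  · have hu' : a + g (u - w) ∉ E := h1 ▸ hu
    rw [Set.indicator_of_notMem (by exact hu')]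
    exact zero_le
end
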